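/- In the poset (ℤ, ≤) viewed as a category, every morphism is right determined by some object. In the poset (ℚ, ≤) viewed as a category, a morphism is right determined by some object if and only if it is an identity morphism. -/

import Mathlib

open CategoryTheory CategoryTheory.Limits Opposite

universe v u

/-- `α'` factors through `α` (both morphisms ending at the same object). -/
def FactorsThru {C : Type*} [Category C] {X' X Y : C} (α' : X' ⟶ Y) (α : X ⟶ Y) : Prop :=
  ∃ φ : X' ⟶ X, φ ≫ α = α'

/-- A morphism `α : X ⟶ Y` is right determined by an object `c` if for every morphism
`α' : X' ⟶ Y`, `α'` factors through `α` iff for every `φ : c ⟶ X'` the composite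
`φ ≫ α'` factors through `α`. -/
def RightDetermined {C : Type*} [Category C] {X Y : C} (α : X ⟶ Y) (c : C) : Prop :=
  ∀ ⦃X' : C⦄ (α' : X' ⟶ Y),
    FactorsThru α' α ↔ ∀ φ : c ⟶ X', FactorsThru (φ ≫ α') α

/-- A morphism is left determined by `c` if it is right determined by `c` as a morphism
of the opposite category. -/
def LeftDetermined {C : Type*} [Category C] {X Y : C} (α : X ⟶ Y) (c : C) : Prop :=
  RightDetermined α.op (op c)

/-- `α : X ⟶ Y` is right minimal if every `φ : X ⟶ X` with `φ ≫ α = α` is an isomorphism. -/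
def RightMinimal {C : Type*} [Category C] {X Y : C} (α : X ⟶ Y) : Prop :=
  ∀ φ : X ⟶ X, φ ≫ α = α → IsIso φ

/-- The image of the induced map `Hom(c, X) → Hom(c, Y)`, as a subset of `Hom(c, Y)`. -/
def ImHom {C : Type*} [Category C] (c : C) {X Y : C} (α : X ⟶ Y) : Set (c ⟶ Y) :=
  {g : c ⟶ Y | ∃ f : c ⟶ X, f ≫ α = g}
theorem rightDetermined_iff_aux {P : Type} [PartialOrder P] {x y : P} (α : x ⟶ y) (c : P) :
    RightDetermined α c ↔ ∀ z : P, z ≤ y → (z ≤ x ↔ (c ≤ z → c ≤ x)) := by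
  have key : ∀ (z : P) (β : z ⟶ y), FactorsThru β α ↔ z ≤ x := fun z β =>
    ⟨fun ⟨φ, _⟩ => leOfHom φ, fun h => ⟨homOfLE h, Subsingleton.elim _ _⟩⟩
  constructor
  · intro H z hz
    have := H (homOfLE hz)
    rw [key] at this
    rw [this]
    exact ⟨fun h hc => (key _ _).1 (h (homOfLE hc)), fun h φ => (key _ _).2 (h (leOfHom φ))⟩
  · intro H z β
    rw [key, H z (leOfHom β)]
    exact ⟨fun h φ => (key _ _).2 (h (leOfHom φ)), fun h hc => (key _ _).1 (h (homOfLE hc))⟩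

/-- In the poset `(ℤ, ≤)` viewed as a category, every morphism is right
determined by some object.  In `(ℚ, ≤)`, a morphism is right determined by some object iff
it is an identity morphism. -/
theorem stmt_4 :
    (∀ (x y : ℤ) (α : x ⟶ y), ∃ c : ℤ, RightDetermined α c) ∧
    (∀ (x y : ℚ) (α : x ⟶ y),
      (∃ c : ℚ, RightDetermined α c) ↔ ∃ h : x = y, α = eqToHom h) := by
  refine ⟨fun x y α => ⟨x + 1, ?_⟩, fun x y α => ⟨?_, ?_⟩⟩
  · rw [rightDetermined_iff_aux]
    intro z _
    omega
  · rintro ⟨c, hc⟩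
    rw [rightDetermined_iff_aux] at hc
    suffices h : x = y from ⟨h, Subsingleton.elim _ _⟩
    by_contra hne
    have hlt : x < y := lt_of_le_of_ne (leOfHom α) hne
    by_cases hcx : c ≤ x
    · exact absurd ((hc y le_rfl).2 fun _ => hcx) (not_le.2 hlt)
    · obtain ⟨z, h1, h2⟩ := exists_between (lt_min (not_le.1 hcx) hlt)
      have hz := (hc z (h2.le.trans (min_le_right _ _))).2 fun h =>
        absurd h (not_le.2 (h2.trans_le (min_le_left _ _)))
      exact absurd hz (not_le.2 h1)
  · rintro ⟨h, _⟩
    refine ⟨x, (rightDetermined_iff_aux α x).2 fun z hz => ?_⟩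
    subst h
    exact ⟨fun _ _ => le_rfl, fun _ => hz⟩
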